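/- Fix a prime p and a positive integer n. The Haar probability measure of the set of forms f ∈ U_n(ℤ_p) that are maximal equals (p² − 1)/p² if p² does not divide n, and equals (p − 1)²(p + 1)/p³ if p² divides n. -/

import Mathlib

/-! Statement 18: the Haar probability measure of the set of maximal forms in U_n(ℤ_p) is (p²-1)/p² if p² ∤ n and (p-1)²(p+1)/p³ if p² ∣ n. -/

open MeasureTheory
open scoped ENNReal

noncomputable section

variable (p : ℕ) [Fact p.Prime]

noncomputable instance : MeasurableSpace (PadicInt p) := borel _
instance : BorelSpace (PadicInt p) := ⟨rfl⟩

/-- The Haar probability measure on `ℤ_p` (the additive Haar measure normalized so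
that `ℤ_p` has measure 1). -/
def padicHaar : Measure (PadicInt p) :=
  Measure.addHaarMeasure ⟨⟨Set.univ, isCompact_univ⟩, by
    rw [interior_univ]; exact Set.univ_nonempty⟩

/-- The Haar probability measure on `U_n(ℤ_p) ≅ ℤ_p³`, coordinates `(b, c, d)`. -/
def padicHaar3 : Measure (PadicInt p × PadicInt p × PadicInt p) :=
  (padicHaar p).prod ((padicHaar p).prod (padicHaar p))

/-- The value of the binary cubic form `nx³ + bx²y + cxy² + dy³` over `ℤ_p`. -/
def formVal (n : ℕ) (t : PadicInt p × PadicInt p × PadicInt p)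
    (x y : PadicInt p) : PadicInt p :=
  (n : PadicInt p) * x ^ 3 + t.1 * x ^ 2 * y + t.2.1 * x * y ^ 2 + t.2.2 * y ^ 3

/-- `f ∈ U_n(ℤ_p)` is nonmaximal: either `p` divides all of `n, b, c, d`, or some
`GL₂(ℤ_p)`-transform `γ·f = a'x³ + b'x²y + c'xy² + d'y³` (with
`(γ·f)(x,y) = det(γ)⁻¹·f((x,y)γ)`) has `p ∣ c'` and `p² ∣ d'`. -/
def IsNonmaximal (n : ℕ) (t : PadicInt p × PadicInt p × PadicInt p) : Prop :=
  ((p : PadicInt p) ∣ (n : PadicInt p) ∧ (p : PadicInt p) ∣ t.1 ∧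
    (p : PadicInt p) ∣ t.2.1 ∧ (p : PadicInt p) ∣ t.2.2) ∨
  ∃ γ : (Matrix (Fin 2) (Fin 2) (PadicInt p))ˣ, ∃ a' b' c' d' : PadicInt p,
    (∀ x y : PadicInt p,
      ((γ⁻¹ : (Matrix (Fin 2) (Fin 2) (PadicInt p))ˣ) :
          Matrix (Fin 2) (Fin 2) (PadicInt p)).det *
        formVal p n t
          (x * (γ : Matrix (Fin 2) (Fin 2) (PadicInt p)) 0 0 +
            y * (γ : Matrix (Fin 2) (Fin 2) (PadicInt p)) 1 0)
          (x * (γ : Matrix (Fin 2) (Fin 2) (PadicInt p)) 0 1 +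
            y * (γ : Matrix (Fin 2) (Fin 2) (PadicInt p)) 1 1) =
      a' * x ^ 3 + b' * x ^ 2 * y + c' * x * y ^ 2 + d' * y ^ 3) ∧
    (p : PadicInt p) ∣ c' ∧ (p : PadicInt p) ^ 2 ∣ d'

section Auxiliary

variable {p}

lemma isUnit_of_not_p_dvd {x : ℤ_[p]} (hx : ¬ (p : ℤ_[p]) ∣ x) : IsUnit x := by
  by_contra h
  exact hx ((PadicInt.norm_lt_one_iff_dvd x).1 (PadicInt.not_isUnit_iff.1 h))

lemma p_dvd_of_sq_dvd {x : ℤ_[p]} (hx : (p : ℤ_[p]) ^ 2 ∣ x) : (p : ℤ_[p]) ∣ x :=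
  (dvd_pow_self _ two_ne_zero).trans hx

lemma p_pow_dvd_natCast_iff (k m : ℕ) : (p : ℤ_[p]) ^ k ∣ (m : ℤ_[p]) ↔ p ^ k ∣ m := by
  have := PadicInt.pow_p_dvd_int_iff (p := p) k m
  rw [Int.cast_natCast] at this
  rw [this]
  exact_mod_cast Iff.rfl

lemma exists_lt_p_dvd_sub (x : ℤ_[p]) : ∃ i < p, (p : ℤ_[p]) ∣ x - (i : ℤ_[p]) := by
  obtain ⟨i, hi, h⟩ := PadicInt.exists_mem_range x
  rw [PadicInt.maximalIdeal_eq_span_p, Ideal.mem_span_singleton] at h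
  exact ⟨i, hi, h⟩

lemma not_p_dvd_natCast_sub {i j : ℕ} (hi : i < p) (hj : j < p) (hij : i ≠ j) :
    ¬ (p : ℤ_[p]) ∣ (j : ℤ_[p]) - (i : ℤ_[p]) := by
  intro h
  have h' : (p : ℤ) ∣ (j : ℤ) - i := by
    have := (PadicInt.pow_p_dvd_int_iff (p := p) 1 ((j : ℤ) - i)).1 (by simpa using h)
    simpa using this
  have := (Nat.modEq_iff_dvd).2 h'
  exact hij (Nat.ModEq.eq_of_lt_of_lt this hi hj)

/-- Two binary cubic forms over `ℤ_p` with the same values have the same coefficients of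
`xy²` and `y³`. -/
lemma cubic_coeff_eq {a b c d a' b' c' d' : ℤ_[p]}
    (h : ∀ x y : ℤ_[p], a * x ^ 3 + b * x ^ 2 * y + c * x * y ^ 2 + d * y ^ 3 =
      a' * x ^ 3 + b' * x ^ 2 * y + c' * x * y ^ 2 + d' * y ^ 3) :
    c = c' ∧ d = d' := by
  have h10 := h 1 0
  have h01 := h 0 1
  have h11 := h 1 1
  have h21 := h 2 1
  have ha : a = a' := by simpa using h10
  have hd : d = d' := by simpa using h01
  subst ha hd
  refine ⟨?_, rfl⟩
  have : (2 : ℤ_[p]) * (c - c') = 0 := by linear_combination 4 * h11 - h21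
  simpa [sub_eq_zero] using this

/-- `f(r, 1)` has a double root at `r` modulo `p` which is a root modulo `p²`. -/
def HasBadRoot (n : ℕ) (t : ℤ_[p] × ℤ_[p] × ℤ_[p]) (r : ℤ_[p]) : Prop :=
  (p : ℤ_[p]) ∣ t.2.1 + (2 * t.1 * r + 3 * n * r ^ 2) ∧
    (p : ℤ_[p]) ^ 2 ∣ t.2.2 + (t.2.1 * r + t.1 * r ^ 2 + n * r ^ 3)

lemma HasBadRoot.congr {n : ℕ} {t : ℤ_[p] × ℤ_[p] × ℤ_[p]} {r s : ℤ_[p]}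
    (h : HasBadRoot n t r) (hrs : (p : ℤ_[p]) ∣ r - s) : HasBadRoot n t s := by
  obtain ⟨⟨u, hu⟩, ⟨v, hv⟩⟩ := h
  obtain ⟨k, hk⟩ := hrs
  obtain rfl : s = r - p * k := by linear_combination -hk
  constructor
  · exact ⟨u - k * (2 * t.1 + 3 * n * (2 * r - p * k)), by linear_combination hu⟩
  · exact ⟨v - k * u + k ^ 2 * (t.1 + 3 * n * r) - n * p * k ^ 3, by
      linear_combination hv - p * k * hu⟩

/-- Bad roots that are distinct modulo `p` force `p` to divide the first two coefficients. -/
lemma HasBadRoot.dvd_of_two {n : ℕ} {t : ℤ_[p] × ℤ_[p] × ℤ_[p]} {r s : ℤ_[p]}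
    (hr : HasBadRoot n t r) (hs : HasBadRoot n t s) (hrs : ¬ (p : ℤ_[p]) ∣ s - r) :
    (p : ℤ_[p]) ∣ n ∧ (p : ℤ_[p]) ∣ t.1 := by
  have hp := PadicInt.prime_p (p := p)
  obtain ⟨⟨C, hC⟩, hD⟩ := hr
  obtain ⟨⟨F, hF⟩, hG⟩ := hs
  obtain ⟨D, hD⟩ := p_dvd_of_sq_dvd hD
  obtain ⟨G, hG⟩ := p_dvd_of_sq_dvd hG
  have hn : (p : ℤ_[p]) ∣ n := by
    have : (p : ℤ_[p]) ∣ n * (s - r) ^ 3 :=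
      ⟨C * (s - r) + 2 * D - 2 * G + (s - r) * F, by
        linear_combination (s - r) * hC + 2 * hD - 2 * hG + (s - r) * hF⟩
    exact (hp.dvd_or_dvd this).resolve_right fun h => hrs (hp.dvd_of_dvd_pow h)
  refine ⟨hn, ?_⟩
  obtain ⟨m, hm⟩ := hn
  have : (p : ℤ_[p]) ∣ t.1 * (s - r) ^ 2 :=
    ⟨G - D - C * (s - r) - m * (s - r) ^ 3 - 3 * m * r * (s - r) ^ 2, by
      linear_combination hG - hD - (s - r) * hC - ((s - r) ^ 3 + 3 * r * (s - r) ^ 2) * hm⟩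
  exact (hp.dvd_or_dvd this).resolve_right fun h => hrs (hp.dvd_of_dvd_pow h)

lemma HasBadRoot.isNonmaximal {n : ℕ} {t : ℤ_[p] × ℤ_[p] × ℤ_[p]} {r : ℤ_[p]}
    (h : HasBadRoot n t r) : IsNonmaximal p n t := by
  refine Or.inr ⟨⟨!![1, 0; r, 1], !![1, 0; -r, 1], ?_, ?_⟩, n, t.1 + 3 * n * r,
    t.2.1 + (2 * t.1 * r + 3 * n * r ^ 2),
    t.2.2 + (t.2.1 * r + t.1 * r ^ 2 + n * r ^ 3), ?_, h⟩
  · ext i j; fin_cases i <;> fin_cases j <;> simp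
  · ext i j; fin_cases i <;> fin_cases j <;> simp
  · intro x y
    simp [formVal, Matrix.det_fin_two]
    ring

lemma isNonmaximal_of_infinity {n : ℕ} {t : ℤ_[p] × ℤ_[p] × ℤ_[p]}
    (hn : (p : ℤ_[p]) ^ 2 ∣ n) (hb : (p : ℤ_[p]) ∣ t.1) : IsNonmaximal p n t := by
  refine Or.inr ⟨⟨!![0, 1; 1, 0], !![0, 1; 1, 0], ?_, ?_⟩, -t.2.2, -t.2.1, -t.1, -n,
    ?_, hb.neg_right, hn.neg_right⟩
  · ext i j; fin_cases i <;> fin_cases j <;> simp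
  · ext i j; fin_cases i <;> fin_cases j <;> simp
  · intro x y
    simp [formVal, Matrix.det_fin_two]
    ring

/-- A primitive vector `(r, s)` at which `f` vanishes modulo `p²` and is singular modulo `p`
corresponds to a bad root or to a singularity at infinity. -/
lemma exists_hasBadRoot_or_infinity {n : ℕ} {t : ℤ_[p] × ℤ_[p] × ℤ_[p]} {r s : ℤ_[p]}
    (hrs : ¬ ((p : ℤ_[p]) ∣ r ∧ (p : ℤ_[p]) ∣ s))
    (hx : (p : ℤ_[p]) ∣ 3 * n * r ^ 2 + 2 * t.1 * r * s + t.2.1 * s ^ 2)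
    (hy : (p : ℤ_[p]) ∣ t.1 * r ^ 2 + 2 * t.2.1 * r * s + 3 * t.2.2 * s ^ 2)
    (hf : (p : ℤ_[p]) ^ 2 ∣ n * r ^ 3 + t.1 * r ^ 2 * s + t.2.1 * r * s ^ 2 + t.2.2 * s ^ 3) :
    ((p : ℤ_[p]) ^ 2 ∣ n ∧ (p : ℤ_[p]) ∣ t.1) ∨ ∃ R, HasBadRoot n t R := by
  have hp := PadicInt.prime_p (p := p)
  by_cases hs : (p : ℤ_[p]) ∣ s
  · left
    have hr : ¬ (p : ℤ_[p]) ∣ r := fun h => hrs ⟨h, hs⟩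
    obtain ⟨k, rfl⟩ := hs
    obtain ⟨y, hy⟩ := hy
    obtain ⟨v, hv⟩ := hf
    have hb : (p : ℤ_[p]) ∣ t.1 := by
      have : (p : ℤ_[p]) ∣ t.1 * r ^ 2 :=
        ⟨y - 2 * t.2.1 * r * k - 3 * t.2.2 * p * k ^ 2, by linear_combination hy⟩
      exact (hp.dvd_or_dvd this).resolve_right fun h => hr (hp.dvd_of_dvd_pow h)
    refine ⟨?_, hb⟩
    obtain ⟨b, hb⟩ := hb
    have : (p : ℤ_[p]) ^ 2 ∣ n * r ^ 3 :=
      ⟨v - b * r ^ 2 * k - t.2.1 * r * k ^ 2 - t.2.2 * p * k ^ 3, by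
        linear_combination hv - p * r ^ 2 * k * hb⟩
    exact ((isUnit_of_not_p_dvd hr).pow 3).dvd_mul_right.1 this
  · right
    obtain ⟨q, hq⟩ := (isUnit_of_not_p_dvd hs).exists_right_inv
    refine ⟨r * q, ?_, ?_⟩
    · refine ((isUnit_of_not_p_dvd hs).pow 2).dvd_mul_right.1 (?_ : _ ∣ _ * s ^ 2)
      convert hx using 1
      linear_combination (2 * t.1 * r * s + 3 * n * r ^ 2 * (s * q + 1)) * hq
    · refine ((isUnit_of_not_p_dvd hs).pow 3).dvd_mul_right.1 (?_ : _ ∣ _ * s ^ 3)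
      convert hf using 1
      linear_combination (t.2.1 * r * s ^ 2 + t.1 * r ^ 2 * s * (s * q + 1) +
        n * r ^ 3 * (s ^ 2 * q ^ 2 + s * q + 1)) * hq

lemma isNonmaximal_iff {n : ℕ} {t : ℤ_[p] × ℤ_[p] × ℤ_[p]} :
    IsNonmaximal p n t ↔
      ((p : ℤ_[p]) ∣ n ∧ (p : ℤ_[p]) ∣ t.1 ∧ (p : ℤ_[p]) ∣ t.2.1 ∧ (p : ℤ_[p]) ∣ t.2.2) ∨
      ((p : ℤ_[p]) ^ 2 ∣ n ∧ (p : ℤ_[p]) ∣ t.1) ∨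
      ∃ i < p, HasBadRoot n t (i : ℤ_[p]) := by
  constructor
  · rintro (h | ⟨γ, a', b', c', d', h, hc, hd⟩)
    · exact Or.inl h
    right
    set α := (γ : Matrix (Fin 2) (Fin 2) ℤ_[p]) 0 0
    set β := (γ : Matrix (Fin 2) (Fin 2) ℤ_[p]) 0 1
    set r := (γ : Matrix (Fin 2) (Fin 2) ℤ_[p]) 1 0
    set s := (γ : Matrix (Fin 2) (Fin 2) ℤ_[p]) 1 1
    set e := ((γ⁻¹ : (Matrix (Fin 2) (Fin 2) ℤ_[p])ˣ) : Matrix (Fin 2) (Fin 2) ℤ_[p]).det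
    have hdet : e * (α * s - β * r) = 1 := by
      rw [← Matrix.det_fin_two, ← Matrix.det_mul, Units.inv_mul, Matrix.det_one]
    have he : IsUnit e := IsUnit.of_mul_eq_one _ hdet
    have hδ : IsUnit (α * s - β * r) := IsUnit.of_mul_eq_one_right _ hdet
    obtain ⟨h1, h2⟩ := cubic_coeff_eq (p := p)
      (a := e * (n * α ^ 3 + t.1 * α ^ 2 * β + t.2.1 * α * β ^ 2 + t.2.2 * β ^ 3))
      (b := e * (r * (3 * n * α ^ 2 + 2 * t.1 * α * β + t.2.1 * β ^ 2) +
        s * (t.1 * α ^ 2 + 2 * t.2.1 * α * β + 3 * t.2.2 * β ^ 2)))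
      (c := e * (α * (3 * n * r ^ 2 + 2 * t.1 * r * s + t.2.1 * s ^ 2) +
        β * (t.1 * r ^ 2 + 2 * t.2.1 * r * s + 3 * t.2.2 * s ^ 2)))
      (d := e * (n * r ^ 3 + t.1 * r ^ 2 * s + t.2.1 * r * s ^ 2 + t.2.2 * s ^ 3))
      (fun x y => (by simp only [formVal]; ring : _ = _).trans (h x y))
    rw [← h1, he.dvd_mul_left] at hc
    rw [← h2, he.dvd_mul_left] at hd
    obtain ⟨u, hu⟩ := hc
    obtain ⟨v, hv⟩ := p_dvd_of_sq_dvd hd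
    have hrs : ¬ ((p : ℤ_[p]) ∣ r ∧ (p : ℤ_[p]) ∣ s) := fun ⟨hr, hs⟩ =>
      PadicInt.prime_p.not_isUnit (isUnit_of_dvd_unit
        (dvd_sub (hs.mul_left α) (hr.mul_left β)) hδ)
    have hx : (p : ℤ_[p]) ∣ 3 * n * r ^ 2 + 2 * t.1 * r * s + t.2.1 * s ^ 2 := by
      refine hδ.dvd_mul_left.1 ⟨s * u - 3 * β * v, ?_⟩
      linear_combination s * hu - 3 * β * hv
    have hy : (p : ℤ_[p]) ∣ t.1 * r ^ 2 + 2 * t.2.1 * r * s + 3 * t.2.2 * s ^ 2 := by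
      refine hδ.dvd_mul_left.1 ⟨3 * α * v - r * u, ?_⟩
      linear_combination 3 * α * hv - r * hu
    refine (exists_hasBadRoot_or_infinity hrs hx hy hd).imp_right fun ⟨R, hR⟩ => ?_
    obtain ⟨i, hi, hRi⟩ := exists_lt_p_dvd_sub R
    exact ⟨i, hi, hR.congr hRi⟩
  · rintro (h | ⟨hn, hb⟩ | ⟨i, -, h⟩)
    · exact Or.inl h
    · exact isNonmaximal_of_infinity hn hb
    · exact h.isNonmaximal

instance : SecondCountableTopology ℤ_[p] := EMetric.secondCountable_of_sigmaCompact _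

instance : IsProbabilityMeasure (padicHaar p) :=
  ⟨Measure.addHaarMeasure_self (K₀ := ⟨⟨Set.univ, isCompact_univ⟩, _⟩)⟩

instance : (padicHaar p).IsAddLeftInvariant := by
  unfold padicHaar; infer_instance

instance : IsProbabilityMeasure (padicHaar3 p) := by
  unfold padicHaar3; infer_instance

lemma setOf_p_pow_dvd_eq_ker (k : ℕ) :
    {x : ℤ_[p] | (p : ℤ_[p]) ^ k ∣ x} =
      ((PadicInt.toZModPow k : ℤ_[p] →+* ZMod (p ^ k)).toAddMonoidHom.ker : Set ℤ_[p]) := by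
  ext x
  have := SetLike.ext_iff.1 (PadicInt.ker_toZModPow (p := p) k) x
  rw [RingHom.mem_ker, Ideal.mem_span_singleton] at this
  exact this.symm

lemma measurableSet_p_pow_dvd (k : ℕ) : MeasurableSet {x : ℤ_[p] | (p : ℤ_[p]) ^ k ∣ x} := by
  have : {x : ℤ_[p] | (p : ℤ_[p]) ^ k ∣ x} = {x : ℤ_[p] | ‖x‖ ≤ (p : ℝ) ^ (-k : ℤ)} := by
    ext x
    simp only [Set.mem_ofPred_eq, PadicInt.norm_le_pow_iff_mem_span_pow,
      Ideal.mem_span_singleton]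
  rw [this]
  exact (isClosed_le continuous_norm continuous_const).measurableSet

lemma padicHaar_p_pow_dvd (k : ℕ) :
    (padicHaar p).real {x : ℤ_[p] | (p : ℤ_[p]) ^ k ∣ x} = ((p : ℝ) ^ k)⁻¹ := by
  set φ := (PadicInt.toZModPow k : ℤ_[p] →+* ZMod (p ^ k)).toAddMonoidHom
  have hsurj : Function.Surjective φ := ZMod.ringHom_surjective (PadicInt.toZModPow k)
  have hidx : φ.ker.index = p ^ k := by
    rw [AddSubgroup.index_ker, AddMonoidHom.range_eq_top.2 hsurj]
    simp
  have : NeZero (p ^ k) := ⟨pow_ne_zero _ (Fact.out : p.Prime).ne_zero⟩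
  have : φ.ker.FiniteIndex := ⟨by rw [hidx]; exact NeZero.ne _⟩
  have hm := measurableSet_p_pow_dvd (p := p) k
  rw [setOf_p_pow_dvd_eq_ker] at hm ⊢
  have h := AddSubgroup.index_mul_measure φ.ker hm (padicHaar p)
  rw [hidx, measure_univ] at h
  have h' := congrArg ENNReal.toReal h
  simp only [ENNReal.toReal_mul, ENNReal.toReal_one, Nat.cast_pow] at h'
  exact eq_inv_of_mul_eq_one_right h'

lemma padicHaar_p_dvd :
    (padicHaar p).real {x : ℤ_[p] | (p : ℤ_[p]) ∣ x} = (p : ℝ)⁻¹ := by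
  simpa using padicHaar_p_pow_dvd (p := p) 1

lemma measurableSet_p_dvd : MeasurableSet {x : ℤ_[p] | (p : ℤ_[p]) ∣ x} := by
  simpa using measurableSet_p_pow_dvd (p := p) 1

/-- Shearing the last two coordinates preserves the Haar measure on `ℤ_p³`. -/
lemma measurePreserving_shear {φ : ℤ_[p] → ℤ_[p]} {ψ : ℤ_[p] → ℤ_[p] → ℤ_[p]}
    (hφ : Continuous φ) (hψ : Continuous (Function.uncurry ψ)) :
    MeasurePreserving
      (fun t : ℤ_[p] × ℤ_[p] × ℤ_[p] => (t.1, t.2.1 + φ t.1, t.2.2 + ψ t.1 t.2.1))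
      (padicHaar3 p) (padicHaar3 p) := by
  refine (MeasurePreserving.id (padicHaar p)).skew_product
    (g := fun b (u : ℤ_[p] × ℤ_[p]) => (u.1 + φ b, u.2 + ψ b u.1))
    (Continuous.measurable (by fun_prop)) (Filter.Eventually.of_forall fun b => ?_)
  refine ((measurePreserving_add_right (padicHaar p) (φ b)).skew_product
    (g := fun c d => d + ψ b c) (Continuous.measurable (by fun_prop))
    (Filter.Eventually.of_forall fun c => ?_)).map_eq
  exact (measurePreserving_add_right (padicHaar p) (ψ b c)).map_eq

lemma measurableSet_shear_box {φ : ℤ_[p] → ℤ_[p]} {ψ : ℤ_[p] → ℤ_[p] → ℤ_[p]}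
    (hφ : Continuous φ) (hψ : Continuous (Function.uncurry ψ)) {B C D : Set ℤ_[p]}
    (hB : MeasurableSet B) (hC : MeasurableSet C) (hD : MeasurableSet D) :
    MeasurableSet {t : ℤ_[p] × ℤ_[p] × ℤ_[p] |
      t.1 ∈ B ∧ t.2.1 + φ t.1 ∈ C ∧ t.2.2 + ψ t.1 t.2.1 ∈ D} :=
  (measurePreserving_shear hφ hψ).measurable (hB.prod (hC.prod hD))

lemma padicHaar3_shear_box {φ : ℤ_[p] → ℤ_[p]} {ψ : ℤ_[p] → ℤ_[p] → ℤ_[p]}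
    (hφ : Continuous φ) (hψ : Continuous (Function.uncurry ψ)) {B C D : Set ℤ_[p]}
    (hB : MeasurableSet B) (hC : MeasurableSet C) (hD : MeasurableSet D) :
    (padicHaar3 p).real {t : ℤ_[p] × ℤ_[p] × ℤ_[p] |
      t.1 ∈ B ∧ t.2.1 + φ t.1 ∈ C ∧ t.2.2 + ψ t.1 t.2.1 ∈ D} =
    (padicHaar p).real B * ((padicHaar p).real C * (padicHaar p).real D) := by
  rw [← measureReal_prod_prod, ← measureReal_prod_prod]
  exact (measurePreserving_shear hφ hψ).measureReal_preimage
    (hB.prod (hC.prod hD)).nullMeasurableSet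

lemma padicHaar3_box {B C D : Set ℤ_[p]} :
    (padicHaar3 p).real (B ×ˢ C ×ˢ D) =
    (padicHaar p).real B * ((padicHaar p).real C * (padicHaar p).real D) := by
  rw [padicHaar3, measureReal_prod_prod, measureReal_prod_prod]

/-- The forms with first free coefficient in `B` having a bad root at `r`. -/
def badRootSet (n : ℕ) (B : Set ℤ_[p]) (r : ℤ_[p]) : Set (ℤ_[p] × ℤ_[p] × ℤ_[p]) :=
  {t | t.1 ∈ B ∧ HasBadRoot n t r}

lemma measurableSet_badRootSet (n : ℕ) {B : Set ℤ_[p]} (hB : MeasurableSet B) (r : ℤ_[p]) :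
    MeasurableSet (badRootSet n B r) :=
  measurableSet_shear_box (φ := fun b => 2 * b * r + 3 * (n : ℤ_[p]) * r ^ 2)
    (ψ := fun b c => c * r + b * r ^ 2 + (n : ℤ_[p]) * r ^ 3) (by fun_prop)
    (by unfold Function.uncurry; fun_prop) hB measurableSet_p_dvd (measurableSet_p_pow_dvd 2)

lemma padicHaar3_badRootSet (n : ℕ) {B : Set ℤ_[p]} (hB : MeasurableSet B) (r : ℤ_[p]) :
    (padicHaar3 p).real (badRootSet n B r) =
      (padicHaar p).real B * ((p : ℝ)⁻¹ * ((p : ℝ) ^ 2)⁻¹) := by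
  refine (padicHaar3_shear_box (φ := fun b => 2 * b * r + 3 * (n : ℤ_[p]) * r ^ 2)
    (ψ := fun b c => c * r + b * r ^ 2 + (n : ℤ_[p]) * r ^ 3) (by fun_prop)
    (by unfold Function.uncurry; fun_prop) hB measurableSet_p_dvd (measurableSet_p_pow_dvd 2)).trans ?_
  rw [padicHaar_p_dvd, padicHaar_p_pow_dvd]

/-- The forms with first free coefficient in `B` having a bad root. -/
def badRootUnion (n : ℕ) (B : Set ℤ_[p]) : Set (ℤ_[p] × ℤ_[p] × ℤ_[p]) :=
  ⋃ i ∈ Finset.range p, badRootSet n B (i : ℤ_[p])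

lemma measurableSet_badRootUnion (n : ℕ) {B : Set ℤ_[p]} (hB : MeasurableSet B) :
    MeasurableSet (badRootUnion n B) :=
  Finset.measurableSet_biUnion _ fun _ _ => measurableSet_badRootSet n hB _

lemma mem_badRootUnion {n : ℕ} {B : Set ℤ_[p]} {t : ℤ_[p] × ℤ_[p] × ℤ_[p]} :
    t ∈ badRootUnion n B ↔ t.1 ∈ B ∧ ∃ i < p, HasBadRoot n t (i : ℤ_[p]) := by
  simp only [badRootUnion, badRootSet, Set.mem_iUnion, Finset.mem_range, Set.mem_ofPred_eq,
    exists_prop]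
  tauto

lemma padicHaar3_badRootUnion (n : ℕ) {B : Set ℤ_[p]} (hB : MeasurableSet B)
    (h : ∀ b ∈ B, ¬ ((p : ℤ_[p]) ∣ n ∧ (p : ℤ_[p]) ∣ b)) :
    (padicHaar3 p).real (badRootUnion n B) = (padicHaar p).real B * ((p : ℝ) ^ 2)⁻¹ := by
  have hp : (p : ℝ) ≠ 0 := by exact_mod_cast (Fact.out : p.Prime).ne_zero
  rw [badRootUnion, measureReal_biUnion_finset]
  · simp only [padicHaar3_badRootSet n hB, Finset.sum_const, Finset.card_range, nsmul_eq_mul]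
    field_simp
  · intro i hi j hj hij
    refine Set.disjoint_left.2 fun t ht ht' => h _ ht.1 (ht.2.dvd_of_two ht'.2 ?_)
    exact not_p_dvd_natCast_sub (by simpa using hi) (by simpa using hj) hij
  · exact fun _ _ => measurableSet_badRootSet n hB _

lemma setOf_isNonmaximal_of_not_dvd {n : ℕ} (hn : ¬ (p : ℤ_[p]) ∣ n) :
    {t | IsNonmaximal p n t} = badRootUnion n Set.univ := by
  ext t
  have hn2 : ¬ (p : ℤ_[p]) ^ 2 ∣ n := fun h => hn (p_dvd_of_sq_dvd h)
  simp [isNonmaximal_iff, mem_badRootUnion, hn, hn2]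

lemma setOf_isNonmaximal_of_dvd {n : ℕ} (hn : (p : ℤ_[p]) ∣ n) (hn2 : ¬ (p : ℤ_[p]) ^ 2 ∣ n) :
    {t | IsNonmaximal p n t} =
      ({x : ℤ_[p] | (p : ℤ_[p]) ∣ x} ×ˢ {x : ℤ_[p] | (p : ℤ_[p]) ∣ x} ×ˢ
        {x : ℤ_[p] | (p : ℤ_[p]) ∣ x}) ∪ badRootUnion n {x : ℤ_[p] | (p : ℤ_[p]) ∣ x}ᶜ := by
  ext t
  simp only [isNonmaximal_iff, mem_badRootUnion, hn, hn2, Set.mem_ofPred_eq, Set.mem_union,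
    Set.mem_prod, Set.mem_compl_iff, true_and, false_and, false_or]
  by_cases hb : (p : ℤ_[p]) ∣ t.1
  · simp only [hb, true_and, not_true_eq_false, false_and, or_false, or_iff_left_iff_imp]
    rintro ⟨i, -, hc, hd⟩
    have hc' : (p : ℤ_[p]) ∣ t.2.1 := (dvd_add_left (dvd_add ((hb.mul_left 2).mul_right _)
      ((hn.mul_left 3).mul_right _))).1 hc
    exact ⟨hc', (dvd_add_left (dvd_add (dvd_add (hc'.mul_right _) (hb.mul_right _))
      (hn.mul_right _))).1 (p_dvd_of_sq_dvd hd)⟩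
  · simp [hb]

lemma setOf_isNonmaximal_of_sq_dvd {n : ℕ} (hn : (p : ℤ_[p]) ^ 2 ∣ n) :
    {t | IsNonmaximal p n t} =
      ({x : ℤ_[p] | (p : ℤ_[p]) ∣ x} ×ˢ Set.univ ×ˢ Set.univ) ∪
        badRootUnion n {x : ℤ_[p] | (p : ℤ_[p]) ∣ x}ᶜ := by
  ext t
  simp only [isNonmaximal_iff, mem_badRootUnion, hn, Set.mem_ofPred_eq, Set.mem_union,
    Set.mem_prod, Set.mem_compl_iff, true_and, Set.mem_univ, and_true]
  tauto

lemma padicHaar_not_p_dvd :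
    (padicHaar p).real {x : ℤ_[p] | (p : ℤ_[p]) ∣ x}ᶜ = 1 - (p : ℝ)⁻¹ := by
  rw [probReal_compl_eq_one_sub measurableSet_p_dvd, padicHaar_p_dvd]

lemma disjoint_prod_badRootUnion (n : ℕ) (B : Set ℤ_[p]) (S : Set (ℤ_[p] × ℤ_[p])) :
    Disjoint (B ×ˢ S) (badRootUnion n Bᶜ) :=
  Set.disjoint_left.2 fun _ ht ht' => (mem_badRootUnion.1 ht').1 ht.1

lemma measurableSet_isNonmaximal (n : ℕ) : MeasurableSet {t | IsNonmaximal p n t} := by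
  by_cases hn2 : (p : ℤ_[p]) ^ 2 ∣ n
  · rw [setOf_isNonmaximal_of_sq_dvd hn2]
    exact (measurableSet_p_dvd.prod (MeasurableSet.univ.prod MeasurableSet.univ)).union
      (measurableSet_badRootUnion n measurableSet_p_dvd.compl)
  by_cases hn : (p : ℤ_[p]) ∣ n
  · rw [setOf_isNonmaximal_of_dvd hn hn2]
    exact (measurableSet_p_dvd.prod (measurableSet_p_dvd.prod measurableSet_p_dvd)).union
      (measurableSet_badRootUnion n measurableSet_p_dvd.compl)
  · rw [setOf_isNonmaximal_of_not_dvd hn]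
    exact measurableSet_badRootUnion n MeasurableSet.univ

lemma padicHaar3_isNonmaximal_of_not_sq_dvd {n : ℕ} (hn2 : ¬ (p : ℤ_[p]) ^ 2 ∣ n) :
    (padicHaar3 p).real {t | IsNonmaximal p n t} = ((p : ℝ) ^ 2)⁻¹ := by
  by_cases hn : (p : ℤ_[p]) ∣ n
  · rw [setOf_isNonmaximal_of_dvd hn hn2, measureReal_union (disjoint_prod_badRootUnion _ _ _)
      (measurableSet_badRootUnion n measurableSet_p_dvd.compl), padicHaar3_box,
      padicHaar3_badRootUnion n measurableSet_p_dvd.compl fun b hb h => hb h.2,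
      padicHaar_not_p_dvd, padicHaar_p_dvd]
    ring
  · rw [setOf_isNonmaximal_of_not_dvd hn,
      padicHaar3_badRootUnion n MeasurableSet.univ fun b _ h => hn h.1]
    simp

lemma padicHaar3_isNonmaximal_of_sq_dvd {n : ℕ} (hn : (p : ℤ_[p]) ^ 2 ∣ n) :
    (padicHaar3 p).real {t | IsNonmaximal p n t} =
      (p : ℝ)⁻¹ + (1 - (p : ℝ)⁻¹) * ((p : ℝ) ^ 2)⁻¹ := by
  rw [setOf_isNonmaximal_of_sq_dvd hn, measureReal_union (disjoint_prod_badRootUnion _ _ _)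
    (measurableSet_badRootUnion n measurableSet_p_dvd.compl), padicHaar3_box,
    padicHaar3_badRootUnion n measurableSet_p_dvd.compl fun b hb h => hb h.2,
    padicHaar_not_p_dvd, padicHaar_p_dvd]
  simp

lemma padicHaar3_not_isNonmaximal (n : ℕ) :
    padicHaar3 p {t | ¬ IsNonmaximal p n t} =
      ENNReal.ofReal (1 - (padicHaar3 p).real {t | IsNonmaximal p n t}) := by
  rw [← probReal_compl_eq_one_sub (measurableSet_isNonmaximal n), ofReal_measureReal]
  rfl

end Auxiliary

/-- Proposition 53 of the paper: the density of maximal forms in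
`U_n(ℤ_p)` is `(p² - 1)/p²` if `p² ∤ n` and `(p - 1)²(p + 1)/p³` if `p² ∣ n`. -/
theorem density_maximal_forms (n : ℕ) (hn : 0 < n) :
    (¬ (p ^ 2 ∣ n) →
      padicHaar3 p {t : PadicInt p × PadicInt p × PadicInt p |
          ¬ IsNonmaximal p n t} =
        ((p : ℝ≥0∞) ^ 2 - 1) / (p : ℝ≥0∞) ^ 2) ∧
    ((p ^ 2 ∣ n) →
      padicHaar3 p {t : PadicInt p × PadicInt p × PadicInt p |
          ¬ IsNonmaximal p n t} =
        ((p : ℝ≥0∞) - 1) ^ 2 * ((p : ℝ≥0∞) + 1) / (p : ℝ≥0∞) ^ 3) := by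

  have hp1 : (1 : ℝ) ≤ p := by exact_mod_cast (Fact.out : p.Prime).one_le
  have hp0 : (0 : ℝ) < p := by linarith
  have hcast : (p : ℝ≥0∞) = ENNReal.ofReal p := by simp
  refine ⟨fun h => ?_, fun h => ?_⟩
  · rw [padicHaar3_not_isNonmaximal,
      padicHaar3_isNonmaximal_of_not_sq_dvd (mt (p_pow_dvd_natCast_iff 2 n).1 h), hcast,
      ← ENNReal.ofReal_pow hp0.le, ← ENNReal.ofReal_one, ← ENNReal.ofReal_sub _ zero_le_one,
      ← ENNReal.ofReal_div_of_pos (by positivity)]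
    congr 1
    field_simp
  · rw [padicHaar3_not_isNonmaximal,
      padicHaar3_isNonmaximal_of_sq_dvd ((p_pow_dvd_natCast_iff 2 n).2 h), hcast,
      ← ENNReal.ofReal_one, ← ENNReal.ofReal_sub _ zero_le_one,
      ← ENNReal.ofReal_add hp0.le zero_le_one, ← ENNReal.ofReal_pow (by linarith),
      ← ENNReal.ofReal_pow hp0.le, ← ENNReal.ofReal_mul (by positivity),
      ← ENNReal.ofReal_div_of_pos (by positivity)]
    congr 1
    field_simp
    ring
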